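/- arXiv:1604.06954 — 3 statements merged into one kernel-verified Lean document; each statement's English description precedes it below -/
import Mathlib

section
/- The downward refinement operator ρ_f defined by the rewrite rules R0, R1, R2, and R3 is locally finite and complete for the quasi-ordered set (G, ⊑), where ⊑ is regular subsumption of directed labeled graphs. -/
/-- A directed labeled graph (DLG) over a label type `L`, with vertices drawn from `ℕ`:
a finite vertex set `V`, a finite edge set `E ⊆ V × V`, and labeling functions for
vertices and edges. -/
structure DLG (L : Type) where
  V : Finset ℕ
  E : Finset (ℕ × ℕ)
  lv : ℕ → L
  le : ℕ × ℕ → L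
  edge_mem : ∀ e ∈ E, e.1 ∈ V ∧ e.2 ∈ V

namespace DLG

variable {L : Type}

/-- Undirected adjacency: there is an edge between `v` and `w` in either direction. -/
def adj (g : DLG L) (v w : ℕ) : Prop :=
  (v, w) ∈ g.E ∨ (w, v) ∈ g.E

/-- A DLG is connected when any two of its vertices are joined by an undirected path. -/
def Connected (g : DLG L) : Prop :=
  ∀ v ∈ g.V, ∀ w ∈ g.V, Relation.ReflTransGen g.adj v w

/-- A canonical fresh vertex not belonging to `g.V`. -/
def fresh (g : DLG L) : ℕ := g.V.sup id + 1

/-- The graph obtained by deleting the edge `e`. -/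
def removeEdge (g : DLG L) (e : ℕ × ℕ) : DLG L where
  V := g.V
  E := g.E.erase e
  lv := g.lv
  le := g.le
  edge_mem := fun e' he' => g.edge_mem e' (Finset.mem_of_mem_erase he')

/-- An edge `e ∈ E` is a bridge of `g` when removing it leaves a disconnected graph. -/
def IsBridge (g : DLG L) (e : ℕ × ℕ) : Prop :=
  e ∈ g.E ∧ ¬ (g.removeEdge e).Connected

/-- The set of edges of `g` incident to the vertex `v`. -/
def incident (g : DLG L) (v : ℕ) : Finset (ℕ × ℕ) :=
  g.E.filter fun e => e.1 = v ∨ e.2 = v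

/-! ### Subsumption relations -/

/-- `m` witnesses that `g₁` subsumes `g₂` (regular subsumption). -/
def SubsWith (g₁ g₂ : DLG L) (m : ℕ → ℕ) : Prop :=
  (∀ v ∈ g₁.V, m v ∈ g₂.V) ∧
  (∀ e ∈ g₁.E, (m e.1, m e.2) ∈ g₂.E) ∧
  (∀ v ∈ g₁.V, g₁.lv v = g₂.lv (m v)) ∧
  (∀ e ∈ g₁.E, g₁.le e = g₂.le (m e.1, m e.2))

/-- Regular subsumption `g₁ ⊑ g₂`. -/
def Subs (g₁ g₂ : DLG L) : Prop := ∃ m, SubsWith g₁ g₂ m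

/-- The object-identity constraint on a vertex mapping: injectivity on `g₁.V`. -/
def OI (g₁ : DLG L) (m : ℕ → ℕ) : Prop :=
  ∀ v₁ ∈ g₁.V, ∀ v₂ ∈ g₁.V, v₁ ≠ v₂ → m v₁ ≠ m v₂

/-- Regular subsumption under object identity. -/
def SubsOI (g₁ g₂ : DLG L) : Prop := ∃ m, SubsWith g₁ g₂ m ∧ OI g₁ m

/-- `m` and `me` witness that `g₁` trans-subsumes `g₂`: each edge of `g₁` is mapped to a
sequence of consecutive edges of `g₂` (given by the list of vertices `me e`), all carrying
the label of the original edge. -/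
def TransSubsWith (g₁ g₂ : DLG L) (m : ℕ → ℕ) (me : ℕ × ℕ → List ℕ) : Prop :=
  (∀ v ∈ g₁.V, m v ∈ g₂.V) ∧
  (∀ v ∈ g₁.V, g₁.lv v = g₂.lv (m v)) ∧
  (∀ e ∈ g₁.E,
    2 ≤ (me e).length ∧
    (me e).head? = some (m e.1) ∧
    (me e).getLast? = some (m e.2) ∧
    (me e).Chain' fun a b => (a, b) ∈ g₂.E ∧ g₂.le (a, b) = g₁.le e)

/-- Trans-subsumption `g₁ ⊑→ g₂`. -/
def TransSubs (g₁ g₂ : DLG L) : Prop := ∃ m me, TransSubsWith g₁ g₂ m me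

/-- The object-identity constraint for trans-subsumption: `m` is injective on `g₁.V`, and
no vertex of `g₁` other than the endpoints of an edge `e` of `g₁` is mapped into the
path `me e`. -/
def TransOI (g₁ : DLG L) (m : ℕ → ℕ) (me : ℕ × ℕ → List ℕ) : Prop :=
  OI g₁ m ∧ ∀ v ∈ g₁.V, ∀ e ∈ g₁.E, v ≠ e.1 → v ≠ e.2 → m v ∉ me e

/-- Trans-subsumption under object identity. -/
def TransSubsOI (g₁ g₂ : DLG L) : Prop :=
  ∃ m me, TransSubsWith g₁ g₂ m me ∧ TransOI g₁ m me

section OrderLabeled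

variable [PartialOrder L]

/-- `m` witnesses subsumption relative to the partial order `≤` (i.e. `⪯`) on labels. -/
def SubsPOWith (g₁ g₂ : DLG L) (m : ℕ → ℕ) : Prop :=
  (∀ v ∈ g₁.V, m v ∈ g₂.V) ∧
  (∀ e ∈ g₁.E, (m e.1, m e.2) ∈ g₂.E) ∧
  (∀ v ∈ g₁.V, g₁.lv v ≤ g₂.lv (m v)) ∧
  (∀ e ∈ g₁.E, g₁.le e ≤ g₂.le (m e.1, m e.2))

/-- Subsumption relative to `⪯`: `g₁ ⊑⪯ g₂`. -/
def SubsPO (g₁ g₂ : DLG L) : Prop := ∃ m, SubsPOWith g₁ g₂ m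

/-- Subsumption relative to `⪯` under object identity. -/
def SubsPOOI (g₁ g₂ : DLG L) : Prop := ∃ m, SubsPOWith g₁ g₂ m ∧ OI g₁ m

/-- `m` and `me` witness trans-subsumption relative to `⪯`. -/
def TransSubsPOWith (g₁ g₂ : DLG L) (m : ℕ → ℕ) (me : ℕ × ℕ → List ℕ) : Prop :=
  (∀ v ∈ g₁.V, m v ∈ g₂.V) ∧
  (∀ v ∈ g₁.V, g₁.lv v ≤ g₂.lv (m v)) ∧
  (∀ e ∈ g₁.E,
    2 ≤ (me e).length ∧
    (me e).head? = some (m e.1) ∧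
    (me e).getLast? = some (m e.2) ∧
    (me e).Chain' fun a b => (a, b) ∈ g₂.E ∧ g₁.le e ≤ g₂.le (a, b))

/-- Trans-subsumption relative to `⪯`: `g₁ ⊑→⪯ g₂`. -/
def TransSubsPO (g₁ g₂ : DLG L) : Prop := ∃ m me, TransSubsPOWith g₁ g₂ m me

/-- Trans-subsumption relative to `⪯` under object identity. -/
def TransSubsPOOI (g₁ g₂ : DLG L) : Prop :=
  ∃ m me, TransSubsPOWith g₁ g₂ m me ∧ TransOI g₁ m me

end OrderLabeled

/-! ### Refinement operators for flat-labeled DLGs -/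

/-- The downward refinement operator `ρ_f`, given by rewrite rules R0, R1, R2, R3. -/
def rho_f (g : DLG L) : Set (DLG L) :=
  {g' |
    -- R0: add a single vertex (labeled `a`) to the empty graph
    (g.V = ∅ ∧ g.E = ∅ ∧ ∃ a : L,
      g'.V = {g.fresh} ∧ g'.E = ∅ ∧
      g'.lv = Function.update g.lv g.fresh a ∧ g'.le = g.le) ∨
    -- R1: add a new vertex `v*` labeled `a` with outgoing edge `(v*, v₁)` labeled `b`
    (∃ v₁ ∈ g.V, ∃ a b : L,
      g'.V = insert g.fresh g.V ∧
      g'.E = insert (g.fresh, v₁) g.E ∧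
      g'.lv = Function.update g.lv g.fresh a ∧
      g'.le = Function.update g.le (g.fresh, v₁) b) ∨
    -- R2: add a new vertex `v*` labeled `a` with incoming edge `(v₁, v*)` labeled `b`
    (∃ v₁ ∈ g.V, ∃ a b : L,
      g'.V = insert g.fresh g.V ∧
      g'.E = insert (v₁, g.fresh) g.E ∧
      g'.lv = Function.update g.lv g.fresh a ∧
      g'.le = Function.update g.le (v₁, g.fresh) b) ∨
    -- R3: add an edge `(v₁, v₂)` labeled `a`
    (∃ v₁ ∈ g.V, ∃ v₂ ∈ g.V, (v₁, v₂) ∉ g.E ∧ ∃ a : L,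
      g'.V = g.V ∧
      g'.E = insert (v₁, v₂) g.E ∧
      g'.lv = g.lv ∧
      g'.le = Function.update g.le (v₁, v₂) a)}

/-- The downward refinement operator `ρ_tf`, given by rules R0–R3 together with the
split-edge rule R4. -/
def rho_tf (g : DLG L) : Set (DLG L) :=
  rho_f g ∪
  -- R4: split an edge `e` by a new vertex labeled `a`; both halves keep the label of `e`
  {g' | ∃ e ∈ g.E, ∃ a : L,
    g'.V = insert g.fresh g.V ∧
    g'.E = insert (e.1, g.fresh) (insert (g.fresh, e.2) (g.E.erase e)) ∧
    g'.lv = Function.update g.lv g.fresh a ∧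
    g'.le = Function.update (Function.update g.le (e.1, g.fresh) (g.le e))
      (g.fresh, e.2) (g.le e)}

/-- The upward refinement operator `γ_f`, given by rewrite rules UR0 and UR1. -/
def gamma_f (g : DLG L) : Set (DLG L) :=
  {g' |
    -- UR0: remove a non-bridge edge
    (∃ e ∈ g.E, ¬ g.IsBridge e ∧ g' = g.removeEdge e) ∨
    -- UR1: remove a vertex incident to at most one edge, with its incident edges
    (∃ v ∈ g.V, (g.incident v).card ≤ 1 ∧
      g'.V = g.V.erase v ∧ g'.E = g.E \ g.incident v ∧
      g'.lv = g.lv ∧ g'.le = g.le)}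

/-- The upward refinement operator `γ_tf`, given by rules UR0, UR1 together with the
shorten-edge rule UR2. -/
def gamma_tf (g : DLG L) : Set (DLG L) :=
  gamma_f g ∪
  -- UR2: replace edges `(v₁,v₂)`, `(v₂,v₃)` with the same label, where `v₂` has no other
  -- incident edges, by a single edge `(v₁,v₃)` with that label, deleting `v₂`
  {g' | ∃ v₁ v₂ v₃ : ℕ, (v₁, v₂) ∈ g.E ∧ (v₂, v₃) ∈ g.E ∧
    g.le (v₁, v₂) = g.le (v₂, v₃) ∧
    (∀ e ∈ g.E, e ≠ (v₁, v₂) → e.2 ≠ v₂) ∧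
    (∀ e ∈ g.E, e ≠ (v₂, v₃) → e.1 ≠ v₂) ∧
    g'.V = g.V.erase v₂ ∧
    g'.E = insert (v₁, v₃) ((g.E.erase (v₁, v₂)).erase (v₂, v₃)) ∧
    g'.lv = g.lv ∧
    g'.le = Function.update g.le (v₁, v₃) (g.le (v₁, v₂))}

/-! ### Refinement operators for order-labeled DLGs
Here the label set carries a partial order `≤` (standing for `⪯`) and `T` denotes the
distinguished most general label `⊤` (with `T ≤ a` for every label `a`). -/

section OrderLabeledOps

variable [PartialOrder L]

/-- The downward refinement operator `ρ_⪯`, given by rules R0PO–R5PO. -/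
def rhoPO (T : L) (g : DLG L) : Set (DLG L) :=
  {g' |
    -- R0PO: add a single vertex labeled ⊤ to the empty graph
    (g.V = ∅ ∧ g.E = ∅ ∧
      g'.V = {g.fresh} ∧ g'.E = ∅ ∧
      g'.lv = Function.update g.lv g.fresh T ∧ g'.le = g.le) ∨
    -- R1PO: add a new vertex `v*` labeled ⊤ and the edge `(v₁, v*)` labeled ⊤
    (∃ v₁ ∈ g.V,
      g'.V = insert g.fresh g.V ∧
      g'.E = insert (v₁, g.fresh) g.E ∧
      g'.lv = Function.update g.lv g.fresh T ∧
      g'.le = Function.update g.le (v₁, g.fresh) T) ∨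
    -- R2PO: add a new vertex `v*` labeled ⊤ and the edge `(v*, v₁)` labeled ⊤
    (∃ v₁ ∈ g.V,
      g'.V = insert g.fresh g.V ∧
      g'.E = insert (g.fresh, v₁) g.E ∧
      g'.lv = Function.update g.lv g.fresh T ∧
      g'.le = Function.update g.le (g.fresh, v₁) T) ∨
    -- R3PO: add an edge `(v₁, v₂)` labeled ⊤
    (∃ v₁ ∈ g.V, ∃ v₂ ∈ g.V, (v₁, v₂) ∉ g.E ∧
      g'.V = g.V ∧ g'.E = insert (v₁, v₂) g.E ∧
      g'.lv = g.lv ∧ g'.le = Function.update g.le (v₁, v₂) T) ∨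
    -- R4PO: refine a vertex label one step downwards in `⪯`
    (∃ v₁ ∈ g.V, ∃ b : L, g.lv v₁ < b ∧ (¬ ∃ c : L, g.lv v₁ < c ∧ c < b) ∧
      g'.V = g.V ∧ g'.E = g.E ∧
      g'.lv = Function.update g.lv v₁ b ∧ g'.le = g.le) ∨
    -- R5PO: refine an edge label one step downwards in `⪯`
    (∃ e ∈ g.E, ∃ b : L, g.le e < b ∧ (¬ ∃ c : L, g.le e < c ∧ c < b) ∧
      g'.V = g.V ∧ g'.E = g.E ∧
      g'.lv = g.lv ∧ g'.le = Function.update g.le e b)}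

/-- The downward refinement operator `ρ_t⪯`, given by rules R0PO–R5PO together with the
split-edge rule R6PO. -/
def rhoTPO (T : L) (g : DLG L) : Set (DLG L) :=
  rhoPO T g ∪
  -- R6PO: split an edge `e` by a new vertex labeled ⊤; both halves keep the label of `e`
  {g' | ∃ e ∈ g.E,
    g'.V = insert g.fresh g.V ∧
    g'.E = insert (e.1, g.fresh) (insert (g.fresh, e.2) (g.E.erase e)) ∧
    g'.lv = Function.update g.lv g.fresh T ∧
    g'.le = Function.update (Function.update g.le (e.1, g.fresh) (g.le e))
      (g.fresh, e.2) (g.le e)}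

/-- The upward refinement operator `γ_⪯`, given by rules UR0PO–UR3PO. -/
def gammaPO (T : L) (g : DLG L) : Set (DLG L) :=
  {g' |
    -- UR0PO: generalize a vertex label one step upwards in `⪯`
    (∃ v₁ ∈ g.V, ∃ b : L, b < g.lv v₁ ∧ (¬ ∃ c : L, b < c ∧ c < g.lv v₁) ∧
      g'.V = g.V ∧ g'.E = g.E ∧
      g'.lv = Function.update g.lv v₁ b ∧ g'.le = g.le) ∨
    -- UR1PO: generalize an edge label one step upwards in `⪯`
    (∃ e ∈ g.E, ∃ b : L, b < g.le e ∧ (¬ ∃ c : L, b < c ∧ c < g.le e) ∧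
      g'.V = g.V ∧ g'.E = g.E ∧
      g'.lv = g.lv ∧ g'.le = Function.update g.le e b) ∨
    -- UR2PO: remove a non-bridge edge labeled ⊤
    (∃ e ∈ g.E, g.le e = T ∧ ¬ g.IsBridge e ∧ g' = g.removeEdge e) ∨
    -- UR3PO: remove a vertex labeled ⊤ incident to at most one edge, all incident
    -- edges being labeled ⊤, together with those edges
    (∃ v ∈ g.V, g.lv v = T ∧ (g.incident v).card ≤ 1 ∧
      (∀ e ∈ g.incident v, g.le e = T) ∧
      g'.V = g.V.erase v ∧ g'.E = g.E \ g.incident v ∧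
      g'.lv = g.lv ∧ g'.le = g.le)}

/-- The upward refinement operator `γ_t⪯`, given by rules UR0PO–UR3PO together with the
shorten-edge rule UR4PO. -/
def gammaTPO (T : L) (g : DLG L) : Set (DLG L) :=
  gammaPO T g ∪
  -- UR4PO: as UR2, additionally requiring the removed middle vertex to be labeled ⊤
  {g' | ∃ v₁ v₂ v₃ : ℕ, (v₁, v₂) ∈ g.E ∧ (v₂, v₃) ∈ g.E ∧
    g.lv v₂ = T ∧
    g.le (v₁, v₂) = g.le (v₂, v₃) ∧
    (∀ e ∈ g.E, e ≠ (v₁, v₂) → e.2 ≠ v₂) ∧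
    (∀ e ∈ g.E, e ≠ (v₂, v₃) → e.1 ≠ v₂) ∧
    g'.V = g.V.erase v₂ ∧
    g'.E = insert (v₁, v₃) ((g.E.erase (v₁, v₂)).erase (v₂, v₃)) ∧
    g'.lv = g.lv ∧
    g'.le = Function.update g.le (v₁, v₃) (g.le (v₁, v₂))}

end OrderLabeledOps

/-- The cover of `g₁` over `g₂` via a mapping `m`: the subgraph of `g₂` consisting of the
vertices and edges referred to by `m`. -/
def cover (g₁ g₂ : DLG L) (m : ℕ → ℕ) : DLG L where
  V := g₁.V.image m
  E := g₁.E.image fun e => (m e.1, m e.2)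
  lv := g₂.lv
  le := g₂.le
  edge_mem := by
    intro e he
    simp only [Finset.mem_image] at he
    obtain ⟨e', he', rfl⟩ := he
    exact ⟨Finset.mem_image_of_mem m (g₁.edge_mem e' he').1,
      Finset.mem_image_of_mem m (g₁.edge_mem e' he').2⟩

end DLG

namespace DLG

variable {L : Type}

theorem fresh_notMem (g : DLG L) : g.fresh ∉ g.V := by
  intro h
  have : g.fresh ≤ g.V.sup id := Finset.le_sup (f := id) h
  simp only [fresh] at this
  omega

/-- A graph is determined by its vertices, edges and labelings. -/
theorem data_injective :
    Function.Injective fun g : DLG L => (g.V, g.E, g.lv, g.le) := by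
  rintro ⟨⟩ ⟨⟩ h
  simp only [Prod.mk.injEq] at h
  obtain ⟨rfl, rfl, rfl, rfl⟩ := h
  rfl

theorem rho_f_finite [Finite L] (g : DLG L) : (rho_f g).Finite := by
  have h0 := Set.finite_range fun a : L =>
    (({g.fresh} : Finset ℕ), (∅ : Finset (ℕ × ℕ)), Function.update g.lv g.fresh a, g.le)
  have h1 := Set.finite_range fun p : g.V × L × L =>
    (insert g.fresh g.V, insert (g.fresh, p.1.1) g.E, Function.update g.lv g.fresh p.2.1,
      Function.update g.le (g.fresh, p.1.1) p.2.2)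
  have h2 := Set.finite_range fun p : g.V × L × L =>
    (insert g.fresh g.V, insert (p.1.1, g.fresh) g.E, Function.update g.lv g.fresh p.2.1,
      Function.update g.le (p.1.1, g.fresh) p.2.2)
  have h3 := Set.finite_range fun p : g.V × g.V × L =>
    (g.V, insert (p.1.1, p.2.1.1) g.E, g.lv, Function.update g.le (p.1.1, p.2.1.1) p.2.2)
  refine ((h0.union (h1.union (h2.union h3))).preimage data_injective.injOn).subset ?_
  rintro g' (⟨-, -, a, hV, hE, hl, hl'⟩ | ⟨v, hv, a, b, hV, hE, hl, hl'⟩ |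
    ⟨v, hv, a, b, hV, hE, hl, hl'⟩ | ⟨v, hv, w, hw, -, a, hV, hE, hl, hl'⟩)
  · exact .inl ⟨a, by simp only [hV, hE, hl, hl']⟩
  · exact .inr (.inl ⟨(⟨v, hv⟩, a, b), by simp only [hV, hE, hl, hl']⟩)
  · exact .inr (.inr (.inl ⟨(⟨v, hv⟩, a, b), by simp only [hV, hE, hl, hl']⟩))
  · exact .inr (.inr (.inr ⟨(⟨v, hv⟩, ⟨w, hw⟩, a), by simp only [hV, hE, hl, hl']⟩))

/-- `g.Reaches h` means that `h` is obtained from `g` by a finite chain of refinements. -/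
abbrev Reaches (g h : DLG L) : Prop :=
  Relation.ReflTransGen (fun x y => y ∈ rho_f x) g h

/-- An edge joins any set of vertices of a connected graph to its complement. -/
theorem Connected.exists_adj {g : DLG L} (hg : g.Connected) {S : Finset ℕ} {a b : ℕ}
    (ha : a ∈ g.V) (haS : a ∈ S) (hb : b ∈ g.V) (hbS : b ∉ S) :
    ∃ v ∈ S, ∃ w ∉ S, g.adj v w := by
  have h := hg a ha b hb
  by_contra! hc
  refine hbS ?_
  clear hb hbS
  induction h with
  | refl => exact haS
  | tail _ hvw ih =>
    by_contra hw
    exact hc _ ih _ hw hvw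

/-- A subsumption mapping extends along the addition of a fresh vertex and an edge `d`. -/
theorem SubsWith.insert_vertex {h g h' : DLG L} {m : ℕ → ℕ} (hm : SubsWith h g m)
    {w : ℕ} (hw : w ∈ g.V) {d : ℕ × ℕ} (hd : d ∉ h.E)
    (hdg : (Function.update m h.fresh w d.1, Function.update m h.fresh w d.2) ∈ g.E)
    (hV : h'.V = insert h.fresh h.V) (hE : h'.E = insert d h.E)
    (hlv : h'.lv = Function.update h.lv h.fresh (g.lv w))
    (hle : h'.le = Function.update h.le d
      (g.le (Function.update m h.fresh w d.1, Function.update m h.fresh w d.2))) :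
    SubsWith h' g (Function.update m h.fresh w) := by
  obtain ⟨hmV, hmE, hmlv, hmle⟩ := hm
  have hne : ∀ v ∈ h.V, v ≠ h.fresh := fun v hv e => h.fresh_notMem (e ▸ hv)
  have hold : ∀ e ∈ h.E, Function.update m h.fresh w e.1 = m e.1 ∧
      Function.update m h.fresh w e.2 = m e.2 := fun e he =>
    ⟨Function.update_of_ne (hne _ (h.edge_mem e he).1) _ _,
      Function.update_of_ne (hne _ (h.edge_mem e he).2) _ _⟩
  refine ⟨?_, ?_, ?_, ?_⟩
  · intro v hv
    rw [hV, Finset.mem_insert] at hv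
    rcases hv with rfl | hv
    · simpa using hw
    · rw [Function.update_of_ne (hne v hv)]
      exact hmV v hv
  · intro e he
    rw [hE, Finset.mem_insert] at he
    rcases he with rfl | he
    · exact hdg
    · rw [(hold e he).1, (hold e he).2]
      exact hmE e he
  · intro v hv
    rw [hV, Finset.mem_insert] at hv
    rw [hlv]
    rcases hv with rfl | hv
    · simp
    · rw [Function.update_of_ne (hne v hv), Function.update_of_ne (hne v hv)]
      exact hmlv v hv
  · intro e he
    rw [hE, Finset.mem_insert] at he
    rw [hle]
    rcases he with rfl | he
    · simp
    · rw [(hold e he).1, (hold e he).2, Function.update_of_ne (ne_of_mem_of_not_mem he hd)]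
      exact hmle e he

/-- If `w` is adjacent to the image of `h` in `g`, one refinement of `h` covers `w` too. -/
theorem SubsWith.exists_refinement_covering {h g : DLG L} {m : ℕ → ℕ} (hm : SubsWith h g m)
    {u w : ℕ} (hu : u ∈ h.V) (huw : g.adj (m u) w) :
    ∃ h' ∈ rho_f h, ∃ m', SubsWith h' g m' ∧ insert w (h.V.image m) ⊆ h'.V.image m' := by
  have hne : ∀ v ∈ h.V, v ≠ h.fresh := fun v hv e => h.fresh_notMem (e ▸ hv)
  have himage : insert w (h.V.image m) ⊆
      (insert h.fresh h.V).image (Function.update m h.fresh w) := by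
    intro x hx
    rw [Finset.mem_insert, Finset.mem_image] at hx
    rw [Finset.mem_image]
    rcases hx with rfl | ⟨v, hv, rfl⟩
    · exact ⟨h.fresh, Finset.mem_insert_self _ _, by simp⟩
    · exact ⟨v, Finset.mem_insert_of_mem hv, Function.update_of_ne (hne v hv) _ _⟩
  have hmu : Function.update m h.fresh w u = m u := Function.update_of_ne (hne u hu) _ _
  have hmem : ∀ e ∈ h.E, e.1 ∈ insert h.fresh h.V ∧ e.2 ∈ insert h.fresh h.V := fun e he =>
    ⟨Finset.mem_insert_of_mem (h.edge_mem e he).1, Finset.mem_insert_of_mem (h.edge_mem e he).2⟩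
  rcases huw with huw | huw
  · refine ⟨⟨insert h.fresh h.V, insert (u, h.fresh) h.E,
      Function.update h.lv h.fresh (g.lv w),
      Function.update h.le (u, h.fresh) (g.le (m u, w)), ?_⟩,
      .inr (.inr (.inl ⟨u, hu, _, _, rfl, rfl, rfl, rfl⟩)), _,
      hm.insert_vertex (w := w) (g.edge_mem _ huw).2 (d := (u, h.fresh))
        (fun he => h.fresh_notMem (h.edge_mem _ he).2) ?_ rfl rfl rfl ?_, himage⟩
    · intro e he
      rcases Finset.mem_insert.1 he with rfl | he
      · exact ⟨Finset.mem_insert_of_mem hu, Finset.mem_insert_self _ _⟩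
      · exact hmem e he
    · simpa [hmu] using huw
    · simp [hmu]
  · refine ⟨⟨insert h.fresh h.V, insert (h.fresh, u) h.E,
      Function.update h.lv h.fresh (g.lv w),
      Function.update h.le (h.fresh, u) (g.le (w, m u)), ?_⟩,
      .inr (.inl ⟨u, hu, _, _, rfl, rfl, rfl, rfl⟩), _,
      hm.insert_vertex (w := w) (g.edge_mem _ huw).1 (d := (h.fresh, u))
        (fun he => h.fresh_notMem (h.edge_mem _ he).1) ?_ rfl rfl rfl ?_, himage⟩
    · intro e he
      rcases Finset.mem_insert.1 he with rfl | he
      · exact ⟨Finset.mem_insert_self _ _, Finset.mem_insert_of_mem hu⟩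
      · exact hmem e he
    · simpa [hmu] using huw
    · simp [hmu]

/-- A nonempty graph subsuming a connected graph `g` refines to one mapping onto the vertices
of `g`. -/
theorem SubsWith.exists_reaches_surjOn {g : DLG L} (hg : g.Connected) {h : DLG L} {m : ℕ → ℕ}
    (hm : SubsWith h g m) (hne : h.V.Nonempty) :
    ∃ h' m', h.Reaches h' ∧ SubsWith h' g m' ∧ g.V ⊆ h'.V.image m' := by
  induction hn : (g.V \ h.V.image m).card using Nat.strong_induction_on generalizing h m with
  | _ n ih =>
  by_cases hsub : g.V ⊆ h.V.image m
  · exact ⟨h, m, .refl, hm, hsub⟩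
  obtain ⟨b, hb, hbS⟩ := Finset.not_subset.1 hsub
  obtain ⟨a, ha⟩ := hne
  obtain ⟨v, hv, w, hw, hvw⟩ := hg.exists_adj (hm.1 a ha) (Finset.mem_image_of_mem m ha) hb hbS
  obtain ⟨u, hu, rfl⟩ := Finset.mem_image.1 hv
  have hwV : w ∈ g.V := hvw.elim (fun e => (g.edge_mem _ e).2) (fun e => (g.edge_mem _ e).1)
  obtain ⟨h', hh', m', hm', hcov⟩ := hm.exists_refinement_covering hu hvw
  have hlt : (g.V \ h'.V.image m').card < n := by
    rw [← hn]
    refine Finset.card_lt_card ((Finset.ssubset_iff_of_subset ?_).2 ⟨w, ?_, ?_⟩)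
    · exact Finset.sdiff_subset_sdiff le_rfl ((Finset.subset_insert _ _).trans hcov)
    · exact Finset.mem_sdiff.2 ⟨hwV, hw⟩
    · exact fun hx => (Finset.mem_sdiff.1 hx).2 (hcov (Finset.mem_insert_self _ _))
  have hne' : h'.V.Nonempty := by
    rw [← Finset.image_nonempty (f := m')]
    exact ⟨w, hcov (Finset.mem_insert_self _ _)⟩
  obtain ⟨k, mk, hk, hrest⟩ := ih _ hlt hm' hne' rfl
  exact ⟨k, mk, .head hh' hk, hrest⟩

/-- Given a section `s` of a subsumption mapping, refining by edges makes `s` preserve any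
prescribed set of edges. -/
theorem SubsWith.exists_reaches_edges {h g : DLG L} {m s : ℕ → ℕ} (hm : SubsWith h g m)
    (hs : ∀ w ∈ g.V, s w ∈ h.V ∧ m (s w) = w) (F : Finset (ℕ × ℕ)) (hF : F ⊆ g.E) :
    ∃ h', h.Reaches h' ∧ h'.V = h.V ∧ SubsWith h' g m ∧ ∀ e ∈ F, (s e.1, s e.2) ∈ h'.E := by
  induction F using Finset.induction_on with
  | empty => exact ⟨h, .refl, rfl, hm, by simp⟩
  | insert d F _ ih =>
    obtain ⟨k, hk, hkV, hkm, hkF⟩ := ih ((Finset.subset_insert _ _).trans hF)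
    have hd : d ∈ g.E := hF (Finset.mem_insert_self _ _)
    have h1 := hs _ (g.edge_mem d hd).1
    have h2 := hs _ (g.edge_mem d hd).2
    by_cases hdk : (s d.1, s d.2) ∈ k.E
    · exact ⟨k, hk, hkV, hkm, Finset.forall_mem_insert _ _ _ |>.2 ⟨hdk, hkF⟩⟩
    rw [← hkV] at h1 h2
    obtain ⟨hmV, hmE, hmlv, hmle⟩ := hkm
    refine ⟨⟨k.V, insert (s d.1, s d.2) k.E, k.lv,
      Function.update k.le (s d.1, s d.2) (g.le d), ?_⟩,
      hk.tail (.inr (.inr (.inr ⟨_, h1.1, _, h2.1, hdk, _, rfl, rfl, rfl, rfl⟩))), hkV,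
      ⟨hmV, ?_, hmlv, ?_⟩, ?_⟩
    · intro e he
      rcases Finset.mem_insert.1 he with rfl | he
      · exact ⟨h1.1, h2.1⟩
      · exact k.edge_mem e he
    · intro e he
      rcases Finset.mem_insert.1 he with rfl | he
      · simpa [h1.2, h2.2] using hd
      · exact hmE e he
    · intro e he
      rcases Finset.mem_insert.1 he with rfl | he
      · simp [h1.2, h2.2]
      · simpa [Function.update_of_ne (fun h => hdk (h ▸ he) : e ≠ (s d.1, s d.2))]
          using hmle e he
    · intro e he
      rcases Finset.mem_insert.1 he with rfl | he
      · exact Finset.mem_insert_self _ _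
      · exact Finset.mem_insert_of_mem (hkF e he)

/-- A nonempty graph subsuming a connected graph refines to a graph equivalent to it. -/
theorem SubsWith.exists_reaches_equiv {g : DLG L} (hg : g.Connected) {h : DLG L} {m : ℕ → ℕ}
    (hm : SubsWith h g m) (hne : h.V.Nonempty) :
    ∃ h', h.Reaches h' ∧ Subs h' g ∧ Subs g h' := by
  obtain ⟨k, mk, hk, hkm, hsurj⟩ := hm.exists_reaches_surjOn hg hne
  have hsec : ∀ w, ∃ v, w ∈ g.V → v ∈ k.V ∧ mk v = w := by
    intro w
    by_cases hw : w ∈ g.V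
    · obtain ⟨v, hv⟩ := Finset.mem_image.1 (hsurj hw)
      exact ⟨v, fun _ => hv⟩
    · exact ⟨0, fun h => absurd h hw⟩
  choose s hs using hsec
  obtain ⟨h', hh', hV, hm', hE⟩ := hkm.exists_reaches_edges hs g.E le_rfl
  refine ⟨h', hk.trans hh', ⟨mk, hm'⟩, s, fun v hv => hV ▸ (hs v hv).1, hE, ?_, ?_⟩
  · intro v hv
    rw [hm'.2.2.1 _ (hV ▸ (hs v hv).1), (hs v hv).2]
  · intro e he
    have := hm'.2.2.2 _ (hE e he)
    rw [this, (hs _ (g.edge_mem e he).1).2, (hs _ (g.edge_mem e he).2).2]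

theorem Subs.exists_reaches_equiv {g₁ g₂ : DLG L} (hg : g₂.Connected) (h : Subs g₁ g₂)
    (hn : ¬ Subs g₂ g₁) : ∃ h, g₁.Reaches h ∧ Subs h g₂ ∧ Subs g₂ h := by
  obtain ⟨m, hm⟩ := h
  rcases g₁.V.eq_empty_or_nonempty with hV | hne
  swap
  · exact hm.exists_reaches_equiv hg hne
  have hE : g₁.E = ∅ := Finset.eq_empty_of_forall_notMem fun e he => by
    simpa [hV] using (g₁.edge_mem e he).1
  rcases g₂.V.eq_empty_or_nonempty with hV₂ | ⟨w, hw⟩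
  · have hE₂ : g₂.E = ∅ := Finset.eq_empty_of_forall_notMem fun e he => by
      simpa [hV₂] using (g₂.edge_mem e he).1
    exact absurd ⟨id, by simp [SubsWith, hV₂, hE₂]⟩ hn
  let k : DLG L := ⟨{g₁.fresh}, ∅, Function.update g₁.lv g₁.fresh (g₂.lv w), g₁.le, by simp⟩
  have hk : k ∈ rho_f g₁ := .inl ⟨hV, hE, _, rfl, rfl, rfl, rfl⟩
  have hkm : SubsWith k g₂ fun _ => w := by simp [SubsWith, k, hw]
  obtain ⟨h, hh, hequiv⟩ := hkm.exists_reaches_equiv hg (Finset.singleton_nonempty _)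
  exact ⟨h, .head hk hh, hequiv⟩

end DLG

theorem rho_f_locally_finite_and_complete {L : Type} [Fintype L] :
    -- locally finite
    (∀ g : DLG L, g.Connected → (DLG.rho_f g).Finite) ∧
    -- complete: if g₁ strictly subsumes g₂, a finite chain of refinements starting
    -- at g₁ reaches a graph equivalent to g₂
    (∀ g₁ g₂ : DLG L, g₁.Connected → g₂.Connected →
      DLG.Subs g₁ g₂ → ¬ DLG.Subs g₂ g₁ →
      ∃ h : DLG L, Relation.ReflTransGen (fun x y => y ∈ DLG.rho_f x) g₁ h ∧
        DLG.Subs h g₂ ∧ DLG.Subs g₂ h) := by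
  exact ⟨fun g _ => g.rho_f_finite, fun _ _ _ hg h hn => h.exists_reaches_equiv hg hn⟩
end

section
/- Under the object identity constraint, the upward refinement operator γ_f defined by the rewrite rules UR0 and UR1 is ideal (locally finite, complete, and proper) for the quasi-ordered set (G, ⊑), where ⊑ is regular subsumption under object identity. -/
namespace DLG

variable {L : Type}

theorem eq_of_fields_eq {g h : DLG L} (hV : g.V = h.V) (hE : g.E = h.E) (hlv : g.lv = h.lv)
    (hle : g.le = h.le) : g = h := by
  cases g; cases h; simp_all

theorem adj_symm {g : DLG L} {v w : ℕ} (h : g.adj v w) : g.adj w v := Or.symm h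

/-- `h` is a subgraph of `g`, with the same labeling functions. -/
structure IsSubgraph (h g : DLG L) : Prop where
  V_subset : h.V ⊆ g.V
  E_subset : h.E ⊆ g.E
  lv_eq : h.lv = g.lv
  le_eq : h.le = g.le

/-! ### Local finiteness -/

theorem gamma_f_finite (g : DLG L) : (gamma_f g).Finite := by
  refine Set.Finite.of_finite_image (f := fun g' => (g'.V, g'.E))
    (((g.V.powerset ×ˢ g.E.powerset).finite_toSet).subset ?_) ?_
  · rintro _ ⟨g', hg', rfl⟩
    simp only [Finset.coe_product, Set.mem_prod, Finset.mem_coe, Finset.mem_powerset]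
    rcases hg' with ⟨e, -, -, rfl⟩ | ⟨v, -, -, hV, hE, -, -⟩
    · exact ⟨subset_rfl, Finset.erase_subset _ _⟩
    · exact ⟨hV ▸ Finset.erase_subset _ _, hE ▸ Finset.sdiff_subset⟩
  · have labels : ∀ g' ∈ gamma_f g, g'.lv = g.lv ∧ g'.le = g.le := by
      rintro g' (⟨e, -, -, rfl⟩ | ⟨v, -, -, -, -, hlv, hle⟩)
      · exact ⟨rfl, rfl⟩
      · exact ⟨hlv, hle⟩
    intro a ha b hb hab
    obtain ⟨hV, hE⟩ := Prod.mk.inj hab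
    exact eq_of_fields_eq hV hE ((labels a ha).1.trans (labels b hb).1.symm)
      ((labels a ha).2.trans (labels b hb).2.symm)

/-! ### Properness -/

theorem SubsOI.card_V_le {g h : DLG L} (hgh : SubsOI g h) : g.V.card ≤ h.V.card := by
  obtain ⟨m, hm, hoi⟩ := hgh
  refine Finset.card_le_card_of_injOn m hm.1 fun v hv w hw hvw => ?_
  by_contra hne
  exact hoi v hv w hw hne hvw

theorem SubsOI.card_E_le {g h : DLG L} (hgh : SubsOI g h) : g.E.card ≤ h.E.card := by
  obtain ⟨m, hm, hoi⟩ := hgh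
  refine Finset.card_le_card_of_injOn (fun e => (m e.1, m e.2)) hm.2.1 fun e he f hf hef => ?_
  obtain ⟨h1, h2⟩ := Prod.mk.inj hef
  have he' := g.edge_mem e he
  have hf' := g.edge_mem f hf
  refine Prod.ext ?_ ?_ <;> by_contra hne
  · exact hoi _ he'.1 _ hf'.1 hne h1
  · exact hoi _ he'.2 _ hf'.2 hne h2

theorem not_subsOI_of_mem_gamma_f {g g' : DLG L} (hg' : g' ∈ gamma_f g) : ¬ SubsOI g g' := by
  intro hsub
  rcases hg' with ⟨e, he, -, rfl⟩ | ⟨v, hv, -, hV, -⟩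
  · exact (Finset.card_erase_lt_of_mem he).not_ge hsub.card_E_le
  · have := hsub.card_V_le
    rw [hV] at this
    exact (Finset.card_erase_lt_of_mem hv).not_ge this

/-! ### Completeness -/

theorem Connected.exists_adj_of_ssubset {g : DLG L} (hg : g.Connected) {S : Finset ℕ}
    (hS : S.Nonempty) (hSV : S ⊂ g.V) : ∃ a ∈ S, ∃ b ∉ S, g.adj a b := by
  obtain ⟨v, hv⟩ := hS
  obtain ⟨w, hw, hwS⟩ := Finset.exists_of_ssubset hSV
  by_contra! hcl
  have closed : ∀ x, Relation.ReflTransGen g.adj v x → x ∈ S := by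
    intro x hx
    induction hx with
    | refl => exact hv
    | tail _ hab ih => exact by_contra fun hb => hcl _ ih _ hb hab
  exact hwS (closed w (hg v (hSV.1 hv) w hw))

theorem Connected.of_V_subset {h g : DLG L} (hh : h.Connected) (hE : h.E ⊆ g.E)
    (hV : g.V ⊆ h.V) : g.Connected := fun v hv w hw =>
  Relation.ReflTransGen.mono (fun _ _ => Or.imp (@hE _) (@hE _)) _ _ (hh v (hV hv) w (hV hw))

theorem Connected.of_adj_insert {h g : DLG L} (hh : h.Connected) (hE : h.E ⊆ g.E) {a b : ℕ}
    (ha : a ∈ h.V) (hV : g.V = insert b h.V) (hab : g.adj a b) : g.Connected := by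
  have path : ∀ x ∈ h.V, ∀ y ∈ h.V, Relation.ReflTransGen g.adj x y := fun x hx y hy =>
    Relation.ReflTransGen.mono (fun _ _ => Or.imp (@hE _) (@hE _)) _ _ (hh x hx y hy)
  intro x hx y hy
  rw [hV, Finset.mem_insert] at hx hy
  rcases hx with rfl | hx <;> rcases hy with rfl | hy
  · exact .refl
  · exact .head (adj_symm hab) (path a ha y hy)
  · exact .tail (path x hx a ha) hab
  · exact path x hx y hy

/-- Extend `h` by the edge `e` of `g`, together with the endpoints of `e`. -/
def addEdge (h : DLG L) (e : ℕ × ℕ) : DLG L where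
  V := insert e.1 (insert e.2 h.V)
  E := insert e h.E
  lv := h.lv
  le := h.le
  edge_mem := by
    intro f hf
    rcases Finset.mem_insert.1 hf with rfl | hf
    · simp
    · have := h.edge_mem f hf
      simp [this.1, this.2]

theorem addEdge_V_of_mem {h : DLG L} {e : ℕ × ℕ} {a b : ℕ} (ha : a ∈ h.V)
    (he : e = (a, b) ∨ e = (b, a)) : (h.addEdge e).V = insert b h.V := by
  rcases he with rfl | rfl <;> simp [addEdge, ha, Finset.insert_eq_of_mem]

theorem IsSubgraph.addEdge {h g : DLG L} (hs : h.IsSubgraph g) {e : ℕ × ℕ} (he : e ∈ g.E) :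
    (h.addEdge e).IsSubgraph g where
  V_subset := Finset.insert_subset (g.edge_mem e he).1
    (Finset.insert_subset (g.edge_mem e he).2 hs.V_subset)
  E_subset := Finset.insert_subset he hs.E_subset
  lv_eq := hs.lv_eq
  le_eq := hs.le_eq

theorem mem_gamma_f_addEdge_of_mem_V {h : DLG L} (hh : h.Connected) {e : ℕ × ℕ} (he : e ∉ h.E)
    (h1 : e.1 ∈ h.V) (h2 : e.2 ∈ h.V) : h ∈ gamma_f (h.addEdge e) := by
  have heq : h = (h.addEdge e).removeEdge e :=
    eq_of_fields_eq (by simp [addEdge, removeEdge, h1, h2]) (by simp [addEdge, removeEdge, he])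
      rfl rfl
  refine Or.inl ⟨e, Finset.mem_insert_self _ _, fun hb => hb.2 ?_, heq⟩
  rwa [← heq]

theorem mem_gamma_f_addEdge_of_notMem_V {h : DLG L} {e : ℕ × ℕ} {a b : ℕ} (ha : a ∈ h.V)
    (hb : b ∉ h.V) (he : e = (a, b) ∨ e = (b, a)) : h ∈ gamma_f (h.addEdge e) := by
  have hbh : ∀ f ∈ h.E, ¬ (f.1 = b ∨ f.2 = b) := by
    rintro f hf (rfl | rfl)
    · exact hb (h.edge_mem f hf).1
    · exact hb (h.edge_mem f hf).2
  have hbe : e.1 = b ∨ e.2 = b := by rcases he with rfl | rfl <;> simp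
  have heE : e ∉ h.E := fun hmem => hbh e hmem hbe
  have hinc : (h.addEdge e).incident b = {e} := by
    simp only [incident, addEdge]
    rw [Finset.filter_insert, if_pos hbe, Finset.filter_false_of_mem hbh,
      insert_empty_eq]
  have hV := addEdge_V_of_mem ha he
  refine Or.inr ⟨b, hV ▸ Finset.mem_insert_self _ _, by simp [hinc], ?_, ?_, rfl, rfl⟩
  · rw [hV, Finset.erase_insert hb]
  · rw [hinc, Finset.sdiff_singleton_eq_erase]
    exact (Finset.erase_insert heE).symm

/-- A proper connected subgraph `h` of a connected graph `g` is the upward refinement of a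
larger connected subgraph of `g`. -/
theorem IsSubgraph.exists_mem_gamma_f {h g : DLG L} (hs : h.IsSubgraph g) (hh : h.Connected)
    (hg : g.Connected) (hne : h ≠ g) :
    ∃ k : DLG L, k.IsSubgraph g ∧ k.Connected ∧ h ∈ gamma_f k ∧
      h.V.card + h.E.card < k.V.card + k.E.card := by
  by_cases hV : h.V = g.V
  · have hE : h.E ⊂ g.E := hs.E_subset.ssubset_of_ne fun hE =>
      hne (eq_of_fields_eq hV hE hs.lv_eq hs.le_eq)
    obtain ⟨e, he, heh⟩ := Finset.exists_of_ssubset hE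
    have hmem := g.edge_mem e he
    rw [← hV] at hmem
    have hkV : (h.addEdge e).V = h.V := by simp [DLG.addEdge, hmem.1, hmem.2]
    refine ⟨h.addEdge e, hs.addEdge he, hh.of_V_subset (Finset.subset_insert _ _) hkV.subset,
      mem_gamma_f_addEdge_of_mem_V hh heh hmem.1 hmem.2, ?_⟩
    rw [hkV, show (h.addEdge e).E = insert e h.E from rfl, Finset.card_insert_of_notMem heh]
    omega
  have hVs : h.V ⊂ g.V := hs.V_subset.ssubset_of_ne hV
  rcases h.V.eq_empty_or_nonempty with hemp | hnonemp
  · obtain ⟨v, hv, -⟩ := Finset.exists_of_ssubset hVs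
    have hE : h.E = ∅ := Finset.eq_empty_of_forall_notMem fun e he => by
      simpa [hemp] using (h.edge_mem e he).1
    refine ⟨⟨{v}, ∅, g.lv, g.le, by simp⟩, ⟨by simpa using hv, by simp, rfl, rfl⟩, ?_, ?_, ?_⟩
    · intro x hx y hy
      rw [Finset.mem_singleton.1 hx, Finset.mem_singleton.1 hy]
    · exact Or.inr ⟨v, by simp, by simp [incident], by simp [hemp], by simp [hE], hs.lv_eq,
        hs.le_eq⟩
    · simp [hemp, hE]
  · obtain ⟨a, ha, b, hb, hab⟩ := hg.exists_adj_of_ssubset hnonemp hVs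
    obtain ⟨e, heg, he⟩ : ∃ e ∈ g.E, e = (a, b) ∨ e = (b, a) := by
      rcases hab with hab | hab
      exacts [⟨_, hab, Or.inl rfl⟩, ⟨_, hab, Or.inr rfl⟩]
    have hV' := addEdge_V_of_mem ha he
    refine ⟨h.addEdge e, hs.addEdge heg, hh.of_adj_insert (Finset.subset_insert _ _) ha hV' ?_,
      mem_gamma_f_addEdge_of_notMem_V ha hb he, ?_⟩
    · rcases he with rfl | rfl
      · exact Or.inl (Finset.mem_insert_self _ _)
      · exact Or.inr (Finset.mem_insert_self _ _)
    · have hEle : h.E.card ≤ (h.addEdge e).E.card :=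
        Finset.card_le_card (Finset.subset_insert _ _)
      rw [hV', Finset.card_insert_of_notMem hb]
      omega

theorem IsSubgraph.reflTransGen_gamma_f {h g : DLG L} (hs : h.IsSubgraph g) (hh : h.Connected)
    (hg : g.Connected) : Relation.ReflTransGen (fun x y => y ∈ gamma_f x) g h := by
  by_cases hne : h = g
  · rw [hne]
  obtain ⟨k, hks, hk, hmem, hlt⟩ := hs.exists_mem_gamma_f hh hg hne
  have hV := Finset.card_le_card hks.V_subset
  have hE := Finset.card_le_card hks.E_subset
  exact (hks.reflTransGen_gamma_f hk hg).tail hmem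
termination_by g.V.card + g.E.card - (h.V.card + h.E.card)

theorem SubsWith.cover_isSubgraph {g₁ g₂ : DLG L} {m : ℕ → ℕ} (hm : SubsWith g₁ g₂ m) :
    (cover g₁ g₂ m).IsSubgraph g₂ where
  V_subset := Finset.image_subset_iff.2 hm.1
  E_subset := Finset.image_subset_iff.2 hm.2.1
  lv_eq := rfl
  le_eq := rfl

theorem Connected.cover {g₁ : DLG L} (h₁ : g₁.Connected) (g₂ : DLG L) (m : ℕ → ℕ) :
    (cover g₁ g₂ m).Connected := by
  intro v hv w hw
  obtain ⟨x, hx, rfl⟩ := Finset.mem_image.1 hv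
  obtain ⟨y, hy, rfl⟩ := Finset.mem_image.1 hw
  refine (h₁ x hx y hy).lift m fun a b hab => ?_
  exact hab.imp (fun h => Finset.mem_image.2 ⟨_, h, rfl⟩) fun h => Finset.mem_image.2 ⟨_, h, rfl⟩

theorem SubsWith.subsOI_cover {g₁ g₂ : DLG L} {m : ℕ → ℕ} (hm : SubsWith g₁ g₂ m)
    (hoi : OI g₁ m) : SubsOI g₁ (cover g₁ g₂ m) :=
  ⟨m, ⟨fun _ hv => Finset.mem_image_of_mem m hv, fun e he => Finset.mem_image.2 ⟨e, he, rfl⟩,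
    hm.2.2.1, hm.2.2.2⟩, hoi⟩

theorem SubsWith.cover_subsOI {g₁ g₂ : DLG L} {m : ℕ → ℕ} (hm : SubsWith g₁ g₂ m)
    (hoi : OI g₁ m) : SubsOI (cover g₁ g₂ m) g₁ := by
  have hinj : Set.InjOn m g₁.V := fun v hv w hw hvw =>
    by_contra fun hne => hoi v hv w hw hne hvw
  have hinv : ∀ v ∈ g₁.V, Function.invFunOn m g₁.V (m v) = v :=
    fun v hv => hinj.leftInvOn_invFunOn hv
  have hinvE : ∀ e ∈ g₁.E,
      (Function.invFunOn m g₁.V (m e.1), Function.invFunOn m g₁.V (m e.2)) = e :=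
    fun e he => Prod.ext (hinv _ (g₁.edge_mem e he).1) (hinv _ (g₁.edge_mem e he).2)
  refine ⟨Function.invFunOn m g₁.V, ⟨?_, ?_, ?_, ?_⟩, ?_⟩
  · exact Finset.forall_mem_image.2 fun v hv => (hinv v hv).symm ▸ hv
  · exact Finset.forall_mem_image.2 fun e he => (hinvE e he).symm ▸ he
  · exact Finset.forall_mem_image.2 fun v hv => by
      rw [hinv v hv]
      exact (hm.2.2.1 v hv).symm
  · exact Finset.forall_mem_image.2 fun e he => by
      rw [hinvE e he]
      exact (hm.2.2.2 e he).symm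
  · refine Finset.forall_mem_image.2 fun v hv => Finset.forall_mem_image.2 fun w hw hne => ?_
    rw [hinv v hv, hinv w hw]
    exact ne_of_apply_ne m hne

end DLG

theorem gamma_f_ideal_under_OI {L : Type} [Fintype L] :
    -- locally finite
    (∀ g : DLG L, g.Connected → (DLG.gamma_f g).Finite) ∧
    -- complete: if g₁ strictly subsumes g₂, a finite chain of upward refinements
    -- starting at g₂ reaches a graph equivalent to g₁
    (∀ g₁ g₂ : DLG L, g₁.Connected → g₂.Connected →
      DLG.SubsOI g₁ g₂ → ¬ DLG.SubsOI g₂ g₁ →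
      ∃ h : DLG L, Relation.ReflTransGen (fun x y => y ∈ DLG.gamma_f x) g₂ h ∧
        DLG.SubsOI h g₁ ∧ DLG.SubsOI g₁ h) ∧
    -- proper: no refinement of g is equivalent to g
    (∀ g : DLG L, g.Connected → ∀ g' ∈ DLG.gamma_f g,
      ¬ (DLG.SubsOI g g' ∧ DLG.SubsOI g' g)) := by
  refine ⟨fun g _ => DLG.gamma_f_finite g, ?_,
    fun g _ g' hg' h => DLG.not_subsOI_of_mem_gamma_f hg' h.1⟩
  rintro g₁ g₂ h₁ h₂ ⟨m, hm, hoi⟩ -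
  exact ⟨DLG.cover g₁ g₂ m, hm.cover_isSubgraph.reflTransGen_gamma_f (h₁.cover g₂ m) h₂,
    hm.cover_subsOI hoi, hm.subsOI_cover hoi⟩
end

section
/- Under the object identity constraint, the downward refinement operator ρ_⪯ defined by the rewrite rules R0PO, R1PO, R2PO, R3PO, R4PO, and R5PO is ideal (locally finite, complete, and proper) for the quasi-ordered set (G, ⊑⪯), where ⊑⪯ is subsumption relative to the partial order ⪯ under object identity. -/
namespace DLG

theorem OI.injOn {L : Type} {g : DLG L} {m : ℕ → ℕ} (hm : OI g m) : Set.InjOn m g.V :=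
  fun v hv w hw h => by_contra fun hne => hm v hv w hw hne h

section Weight

variable {L : Type} [PartialOrder L]

/-- The number of labels strictly more general than `a`, plus one. -/
noncomputable def labelWeight (a : L) : ℕ := (Set.Iio a).ncard + 1

theorem labelWeight_strictMono [Finite L] : StrictMono (labelWeight (L := L)) := fun _ _ hab =>
  Nat.add_lt_add_right (Set.ncard_lt_ncard (Set.Iio_ssubset_Iio hab) (Set.toFinite _)) 1

theorem labelWeight_pos (a : L) : 0 < labelWeight a := Nat.succ_pos _

theorem sum_labelWeight_le [Finite L] {α β : Type*} {s : Finset α} {t : Finset β}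
    {f : α → L} {g : β → L} {i : α → β} (hi : Set.InjOn i s) (hst : ∀ x ∈ s, i x ∈ t)
    (hfg : ∀ x ∈ s, f x ≤ g (i x)) :
    ∑ x ∈ s, labelWeight (f x) ≤ ∑ y ∈ t, labelWeight (g y) := by
  classical
  calc ∑ x ∈ s, labelWeight (f x) ≤ ∑ x ∈ s, labelWeight (g (i x)) :=
        Finset.sum_le_sum fun x hx => labelWeight_strictMono.monotone (hfg x hx)
    _ = ∑ y ∈ s.image i, labelWeight (g y) :=
        (Finset.sum_image (f := fun y => labelWeight (g y)) hi).symm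
    _ ≤ ∑ y ∈ t, labelWeight (g y) :=
        Finset.sum_le_sum_of_subset (Finset.image_subset_iff.2 hst)

theorem sum_labelWeight_lt [Finite L] {α : Type*} {s t : Finset α} {f g : α → L}
    (hst : s ⊆ t) (hfg : ∀ x ∈ s, f x ≤ g x) (hlt : ∃ x ∈ t, x ∈ s → f x < g x) :
    ∑ x ∈ s, labelWeight (f x) < ∑ x ∈ t, labelWeight (g x) := by
  classical
  rw [← Finset.inter_eq_right.2 hst, ← Finset.sum_ite_mem]
  obtain ⟨x, hxt, hx⟩ := hlt
  refine Finset.sum_lt_sum (fun y _ => ?_) ⟨x, hxt, ?_⟩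
  · split_ifs with h
    · exact labelWeight_strictMono.monotone (hfg y h)
    · exact Nat.zero_le _
  · split_ifs with h
    · exact labelWeight_strictMono (hx h)
    · exact labelWeight_pos _

/-- The total weight of the vertex and edge labels of `g`. -/
noncomputable def weight (g : DLG L) : ℕ :=
  ∑ v ∈ g.V, labelWeight (g.lv v) + ∑ e ∈ g.E, labelWeight (g.le e)

theorem SubsPOOI.weight_le [Finite L] {g g' : DLG L} (h : SubsPOOI g g') :
    g.weight ≤ g'.weight := by
  obtain ⟨m, ⟨hV, hE, hlv, hle⟩, hm⟩ := h
  refine Nat.add_le_add (sum_labelWeight_le hm.injOn hV hlv)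
    (sum_labelWeight_le (i := fun e => (m e.1, m e.2)) ?_ hE hle)
  intro e he e' he' h
  obtain ⟨h₁, h₂⟩ := Prod.mk.inj h
  exact Prod.ext (hm.injOn (g.edge_mem e he).1 (g.edge_mem e' he').1 h₁)
    (hm.injOn (g.edge_mem e he).2 (g.edge_mem e' he').2 h₂)

theorem weight_lt [Finite L] {g g' : DLG L} (hV : g.V ⊆ g'.V) (hE : g.E ⊆ g'.E)
    (hlv : ∀ v ∈ g.V, g.lv v ≤ g'.lv v) (hle : ∀ e ∈ g.E, g.le e ≤ g'.le e)
    (hlt : (∃ v ∈ g'.V, v ∈ g.V → g.lv v < g'.lv v) ∨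
      ∃ e ∈ g'.E, e ∈ g.E → g.le e < g'.le e) : g.weight < g'.weight := by
  rcases hlt with h | h
  · exact Nat.add_lt_add_of_lt_of_le (sum_labelWeight_lt hV hlv h)
      (sum_labelWeight_le (i := id) (Set.injOn_id _) hE hle)
  · exact Nat.add_lt_add_of_le_of_lt
      (sum_labelWeight_le (i := id) (Set.injOn_id _) hV hlv) (sum_labelWeight_lt hE hle h)

end Weight

section Refinement

variable {L : Type}

theorem ne_fresh {g : DLG L} {v : ℕ} (hv : v ∈ g.V) : v ≠ g.fresh :=
  fun h => g.fresh_notMem (h ▸ hv)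

theorem update_fresh_of_mem {g : DLG L} {m : ℕ → ℕ} {y v : ℕ} (hv : v ∈ g.V) :
    Function.update m g.fresh y v = m v := Function.update_of_ne (ne_fresh hv) _ _

theorem OI.update_fresh {g h : DLG L} {m : ℕ → ℕ} {y : ℕ} (hm : OI g m) (hy : ∀ v ∈ g.V, m v ≠ y)
    (hV : h.V = insert g.fresh g.V) : OI h (Function.update m g.fresh y) := by
  intro v hv w hw hvw
  rw [hV, Finset.mem_insert] at hv hw
  rcases hv with rfl | hv <;> rcases hw with rfl | hw
  · exact absurd rfl hvw
  · rw [update_fresh_of_mem hw, Function.update_self]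
    exact (hy w hw).symm
  · rw [update_fresh_of_mem hv, Function.update_self]
    exact hy v hv
  · rw [update_fresh_of_mem hw, update_fresh_of_mem hv]
    exact hm v hv w hw hvw

theorem ext_iff_fields {g g' : DLG L} :
    g = g' ↔ g.V = g'.V ∧ g.E = g'.E ∧ g.lv = g'.lv ∧ g.le = g'.le := by
  constructor
  · rintro rfl
    exact ⟨rfl, rfl, rfl, rfl⟩
  · rintro ⟨hV, hE, hlv, hle⟩
    cases g
    cases g'
    cases hV
    cases hE
    cases hlv
    cases hle
    rfl

theorem finite_setOf_fields (V : Finset ℕ) (E : Finset (ℕ × ℕ)) (lv : ℕ → L)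
    (le : ℕ × ℕ → L) :
    {g : DLG L | g.V = V ∧ g.E = E ∧ g.lv = lv ∧ g.le = le}.Finite := by
  refine Set.Subsingleton.finite ?_
  rintro g ⟨hV, hE, hlv, hle⟩ g' ⟨hV', hE', hlv', hle'⟩
  exact ext_iff_fields.2
    ⟨hV.trans hV'.symm, hE.trans hE'.symm, hlv.trans hlv'.symm, hle.trans hle'.symm⟩

variable [PartialOrder L]

theorem finite_rhoPO [Finite L] (T : L) (g : DLG L) : (rhoPO T g).Finite := by
  have hV := g.V.finite_toSet
  have hE := g.E.finite_toSet
  have hL := Set.finite_univ (α := L)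
  have h0 := finite_setOf_fields {g.fresh} ∅ (Function.update g.lv g.fresh T) g.le
  have h1 := hV.biUnion fun v _ => finite_setOf_fields (insert g.fresh g.V)
    (insert (v, g.fresh) g.E) (Function.update g.lv g.fresh T)
    (Function.update g.le (v, g.fresh) T)
  have h2 := hV.biUnion fun v _ => finite_setOf_fields (insert g.fresh g.V)
    (insert (g.fresh, v) g.E) (Function.update g.lv g.fresh T)
    (Function.update g.le (g.fresh, v) T)
  have h3 := hV.biUnion fun v _ => hV.biUnion fun w _ => finite_setOf_fields g.V
    (insert (v, w) g.E) g.lv (Function.update g.le (v, w) T)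
  have h4 := hV.biUnion fun v _ => hL.biUnion fun b _ => finite_setOf_fields g.V g.E
    (Function.update g.lv v b) g.le
  have h5 := hE.biUnion fun e _ => hL.biUnion fun b _ => finite_setOf_fields g.V g.E g.lv
    (Function.update g.le e b)
  refine (h0.union (h1.union (h2.union (h3.union (h4.union h5))))).subset ?_
  rintro g' (⟨-, -, h⟩ | ⟨v, hv, h⟩ | ⟨v, hv, h⟩ | ⟨v, hv, w, hw, -, h⟩ | ⟨v, hv, b, -, -, h⟩ |
    ⟨e, he, b, -, -, h⟩)
  · exact Or.inl h
  · exact Or.inr (Or.inl (Set.mem_biUnion hv h))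
  · exact Or.inr (Or.inr (Or.inl (Set.mem_biUnion hv h)))
  · exact Or.inr (Or.inr (Or.inr (Or.inl (Set.mem_biUnion hv (Set.mem_biUnion hw h)))))
  · exact Or.inr (Or.inr (Or.inr (Or.inr (Or.inl
      (Set.mem_biUnion hv (Set.mem_biUnion (Set.mem_univ b) h))))))
  · exact Or.inr (Or.inr (Or.inr (Or.inr (Or.inr
      (Set.mem_biUnion he (Set.mem_biUnion (Set.mem_univ b) h))))))

theorem le_update_of_imp {α : Type*} [DecidableEq α] {f : α → L} {a x : α} {b : L}
    (h : x = a → f x ≤ b) : f x ≤ Function.update f a b x := by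
  by_cases hx : x = a
  · subst hx
    simpa using h rfl
  · simp [hx]

theorem weight_lt_of_mem_rhoPO [Finite L] {T : L} {g g' : DLG L} (h : g' ∈ rhoPO T g) :
    g.weight < g'.weight := by
  have hfv : ∀ v ∈ g.V, g.lv v ≤ Function.update g.lv g.fresh T v := fun v hv =>
    le_update_of_imp fun h => absurd h (ne_fresh hv)
  rcases h with ⟨hV, hE, hV', hE', -, -⟩ | ⟨v, hv, hV', hE', hlv, hle⟩ |
    ⟨v, hv, hV', hE', hlv, hle⟩ | ⟨v, hv, w, hw, hn, hV', hE', hlv, hle⟩ |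
    ⟨v, hv, b, hb, -, hV', hE', hlv, hle⟩ | ⟨e, he, b, hb, -, hV', hE', hlv, hle⟩
  · exact weight_lt (by simp [hV]) (by simp [hE]) (by simp [hV]) (by simp [hE])
      (Or.inl ⟨g.fresh, by simp [hV'], by simp [hV]⟩)
  · refine weight_lt (by simp [hV']) (by simp [hE']) (hlv ▸ hfv) (fun e he => ?_)
      (Or.inl ⟨g.fresh, by simp [hV'], fun h => absurd h g.fresh_notMem⟩)
    rw [hle]
    exact le_update_of_imp fun h => absurd (by simp [h]) (ne_fresh (g.edge_mem e he).2)
  · refine weight_lt (by simp [hV']) (by simp [hE']) (hlv ▸ hfv) (fun e he => ?_)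
      (Or.inl ⟨g.fresh, by simp [hV'], fun h => absurd h g.fresh_notMem⟩)
    rw [hle]
    exact le_update_of_imp fun h => absurd (by simp [h]) (ne_fresh (g.edge_mem e he).1)
  · refine weight_lt (by simp [hV']) (by simp [hE']) (by simp [hlv]) (fun e he => ?_)
      (Or.inr ⟨(v, w), by simp [hE'], fun h => absurd h hn⟩)
    rw [hle]
    exact le_update_of_imp fun h => absurd (h ▸ he) hn
  · refine weight_lt hV'.ge hE'.ge (fun x _ => ?_) (by simp [hle])
      (Or.inl ⟨v, hV' ▸ hv, fun _ => by simpa [hlv] using hb⟩)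
    rw [hlv]
    exact le_update_of_imp fun h => h ▸ hb.le
  · refine weight_lt hV'.ge hE'.ge (by simp [hlv]) (fun x _ => ?_)
      (Or.inr ⟨e, hE' ▸ he, fun _ => by simpa [hle] using hb⟩)
    rw [hle]
    exact le_update_of_imp fun h => h ▸ hb.le

theorem update_le_of_imp {α : Type*} [DecidableEq α] {f : α → L} {a x : α} {b c : L}
    (hb : x = a → b ≤ c) (hf : x ≠ a → f x ≤ c) : Function.update f a b x ≤ c := by
  by_cases hx : x = a
  · subst hx
    simpa using hb rfl
  · simpa [hx] using hf hx

theorem exists_minimal_gt_le [Finite L] {a c : L} (h : a < c) :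
    ∃ b, a < b ∧ b ≤ c ∧ ¬ ∃ d, a < d ∧ d < b := by
  obtain ⟨b, hbc, hab⟩ := exists_covBy_le_of_lt h
  exact ⟨b, hbc.lt, hab, fun ⟨d, hd, hdb⟩ => hbc.2 hd hdb⟩

/-- A path leaving a set of vertices contains an edge leaving that set. -/
theorem exists_adj_of_reflTransGen {α : Type*} {r : α → α → Prop} {s : Set α} {v w : α}
    (h : Relation.ReflTransGen r v w) (hv : v ∈ s) (hw : w ∉ s) :
    ∃ x ∈ s, ∃ y ∉ s, r x y := by
  induction h with
  | refl => exact absurd hv hw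
  | @tail y z _ hyz ih =>
    by_cases hy : y ∈ s
    · exact ⟨y, hy, z, hw, hyz⟩
    · exact ih hy

/-- Adding a fresh vertex and an edge `e` at it, both carrying the least label, preserves
subsumption when the enlarged vertex mapping sends `e` to an edge. -/
theorem SubsPOWith.update_fresh {g g' h : DLG L} {m : ℕ → ℕ} {y : ℕ} {T : L}
    {e : ℕ × ℕ} (hT : ∀ a : L, T ≤ a) (hm : SubsPOWith g g' m) (hy : y ∈ g'.V)
    (he : (Function.update m g.fresh y e.1, Function.update m g.fresh y e.2) ∈ g'.E)
    (hV : h.V = insert g.fresh g.V) (hE : h.E = insert e g.E)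
    (hlv : h.lv = Function.update g.lv g.fresh T) (hle : h.le = Function.update g.le e T) :
    SubsPOWith h g' (Function.update m g.fresh y) := by
  obtain ⟨mV, mE, mlv, mle⟩ := hm
  refine ⟨fun v hv => ?_, fun d hd => ?_, fun v hv => ?_, fun d hd => ?_⟩
  · rw [hV, Finset.mem_insert] at hv
    rcases hv with rfl | hv
    · simpa using hy
    · rw [update_fresh_of_mem hv]
      exact mV v hv
  · rw [hE, Finset.mem_insert] at hd
    rcases hd with rfl | hd
    · exact he
    · rw [update_fresh_of_mem (g.edge_mem d hd).1, update_fresh_of_mem (g.edge_mem d hd).2]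
      exact mE d hd
  · rw [hlv]
    refine update_le_of_imp (fun _ => hT _) fun hne => ?_
    have hv' : v ∈ g.V := (Finset.mem_insert.1 (hV ▸ hv)).resolve_left hne
    rw [update_fresh_of_mem hv']
    exact mlv v hv'
  · rw [hle]
    refine update_le_of_imp (fun _ => hT _) fun hne => ?_
    have hd' : d ∈ g.E := (Finset.mem_insert.1 (hE ▸ hd)).resolve_left hne
    rw [update_fresh_of_mem (g.edge_mem d hd').1, update_fresh_of_mem (g.edge_mem d hd').2]
    exact mle d hd'

theorem exists_rhoPO_addVertex {T : L} (hT : ∀ a : L, T ≤ a) {g g' : DLG L} {m : ℕ → ℕ}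
    (hg' : g'.Connected) (hm : SubsPOWith g g' m) (hoi : OI g m) {y : ℕ} (hy : y ∈ g'.V)
    (hny : ∀ v ∈ g.V, m v ≠ y) : ∃ h ∈ rhoPO T g, SubsPOOI h g' := by
  rcases g.V.eq_empty_or_nonempty with hV | ⟨x, hx⟩
  · have hE : g.E = ∅ := Finset.eq_empty_of_forall_notMem fun e he => by
      simpa [hV] using (g.edge_mem e he).1
    refine ⟨⟨{g.fresh}, ∅, Function.update g.lv g.fresh T, g.le, by simp⟩,
      Or.inl ⟨hV, hE, rfl, rfl, rfl, rfl⟩, fun _ => y, ⟨?_, ?_, ?_, ?_⟩, ?_⟩ <;>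
      simp [hy, hT, OI]
  · have hns : y ∉ m '' g.V := fun ⟨v, hv, h⟩ => hny v hv h
    obtain ⟨_, ⟨v, hv, rfl⟩, z, hz, hvz⟩ := exists_adj_of_reflTransGen
      (hg' (m x) (hm.1 x hx) y hy) (Set.mem_image_of_mem m hx) hns
    have hnz : ∀ v ∈ g.V, m v ≠ z := fun v hv h => hz ⟨v, hv, h⟩
    have hv' : v ∈ g.V := hv
    rcases hvz with h | h
    · refine ⟨⟨insert g.fresh g.V, insert (v, g.fresh) g.E, Function.update g.lv g.fresh T,
        Function.update g.le (v, g.fresh) T, ?_⟩,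
        Or.inr (Or.inl ⟨v, hv, rfl, rfl, rfl, rfl⟩), _,
        hm.update_fresh hT (g'.edge_mem _ h).2 ?_ rfl rfl rfl rfl,
        hoi.update_fresh hnz rfl⟩
      · intro e he
        rcases Finset.mem_insert.1 he with rfl | he
        · simp [hv']
        · simp [g.edge_mem e he]
      · simpa [update_fresh_of_mem hv'] using h
    · refine ⟨⟨insert g.fresh g.V, insert (g.fresh, v) g.E, Function.update g.lv g.fresh T,
        Function.update g.le (g.fresh, v) T, ?_⟩,
        Or.inr (Or.inr (Or.inl ⟨v, hv, rfl, rfl, rfl, rfl⟩)), _,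
        hm.update_fresh hT (g'.edge_mem _ h).1 ?_ rfl rfl rfl rfl,
        hoi.update_fresh hnz rfl⟩
      · intro e he
        rcases Finset.mem_insert.1 he with rfl | he
        · simp [hv']
        · simp [g.edge_mem e he]
      · simpa [update_fresh_of_mem hv'] using h

theorem exists_rhoPO_addEdge {T : L} (hT : ∀ a : L, T ≤ a) {g g' : DLG L} {m : ℕ → ℕ}
    (hm : SubsPOWith g g' m) (hoi : OI g m) {v w : ℕ} (hv : v ∈ g.V) (hw : w ∈ g.V)
    (hvw : (v, w) ∉ g.E) (hmem : (m v, m w) ∈ g'.E) : ∃ h ∈ rhoPO T g, SubsPOOI h g' := by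
  obtain ⟨mV, mE, mlv, mle⟩ := hm
  refine ⟨⟨g.V, insert (v, w) g.E, g.lv, Function.update g.le (v, w) T, ?_⟩,
    Or.inr (Or.inr (Or.inr (Or.inl ⟨v, hv, w, hw, hvw, rfl, rfl, rfl, rfl⟩))),
    m, ⟨mV, fun e he => ?_, mlv, fun e he => ?_⟩, hoi⟩
  · intro e he
    rcases Finset.mem_insert.1 he with rfl | he
    · exact ⟨hv, hw⟩
    · exact g.edge_mem e he
  · rcases Finset.mem_insert.1 he with rfl | he
    · exact hmem
    · exact mE e he
  · exact update_le_of_imp (fun _ => hT _) fun hne =>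
      mle e ((Finset.mem_insert.1 he).resolve_left hne)

theorem exists_rhoPO_refineVertex [Finite L] (T : L) {g g' : DLG L} {m : ℕ → ℕ}
    (hm : SubsPOWith g g' m) (hoi : OI g m) {v : ℕ} (hv : v ∈ g.V)
    (hlt : g.lv v < g'.lv (m v)) : ∃ h ∈ rhoPO T g, SubsPOOI h g' := by
  obtain ⟨mV, mE, mlv, mle⟩ := hm
  obtain ⟨b, hab, hbc, hb⟩ := exists_minimal_gt_le hlt
  exact ⟨⟨g.V, g.E, Function.update g.lv v b, g.le, g.edge_mem⟩,
    Or.inr (Or.inr (Or.inr (Or.inr (Or.inl ⟨v, hv, b, hab, hb, rfl, rfl, rfl, rfl⟩)))),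
    m, ⟨mV, mE, fun w hw => update_le_of_imp (fun h => h ▸ hbc) fun _ => mlv w hw, mle⟩, hoi⟩

theorem exists_rhoPO_refineEdge [Finite L] (T : L) {g g' : DLG L} {m : ℕ → ℕ}
    (hm : SubsPOWith g g' m) (hoi : OI g m) {e : ℕ × ℕ} (he : e ∈ g.E)
    (hlt : g.le e < g'.le (m e.1, m e.2)) : ∃ h ∈ rhoPO T g, SubsPOOI h g' := by
  obtain ⟨mV, mE, mlv, mle⟩ := hm
  obtain ⟨b, hab, hbc, hb⟩ := exists_minimal_gt_le hlt
  exact ⟨⟨g.V, g.E, g.lv, Function.update g.le e b, g.edge_mem⟩,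
    Or.inr (Or.inr (Or.inr (Or.inr (Or.inr ⟨e, he, b, hab, hb, rfl, rfl, rfl, rfl⟩)))),
    m, ⟨mV, mE, mlv, fun d hd => update_le_of_imp (fun h => h ▸ hbc) fun _ => mle d hd⟩, hoi⟩

/-- An injective label-preserving mapping that is onto vertices and edges can be inverted. -/
theorem subsPOOI_symm_of_surj {g g' : DLG L} {m : ℕ → ℕ}
    (hV : ∀ y ∈ g'.V, ∃ v ∈ g.V, m v = y)
    (hE : ∀ v ∈ g.V, ∀ w ∈ g.V, (m v, m w) ∈ g'.E → (v, w) ∈ g.E)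
    (hlv : ∀ v ∈ g.V, g'.lv (m v) ≤ g.lv v)
    (hle : ∀ e ∈ g.E, g'.le (m e.1, m e.2) ≤ g.le e) : SubsPOOI g' g := by
  choose! n hnV hmn using hV
  have hnE : ∀ e ∈ g'.E, (n e.1, n e.2) ∈ g.E := fun e he => by
    have h := g'.edge_mem e he
    exact hE _ (hnV _ h.1) _ (hnV _ h.2) (by rwa [hmn _ h.1, hmn _ h.2])
  refine ⟨n, ⟨hnV, hnE, fun v hv => ?_, fun e he => ?_⟩, fun v hv w hw hne h => hne ?_⟩
  · simpa [hmn v hv] using hlv _ (hnV v hv)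
  · have h := g'.edge_mem e he
    simpa [hmn _ h.1, hmn _ h.2] using hle _ (hnE e he)
  · rw [← hmn v hv, h, hmn w hw]

theorem exists_rhoPO_subsPOOI [Finite L] {T : L} (hT : ∀ a : L, T ≤ a) {g g' : DLG L}
    (hg' : g'.Connected) (h : SubsPOOI g g') (hn : ¬ SubsPOOI g' g) :
    ∃ k ∈ rhoPO T g, SubsPOOI k g' := by
  obtain ⟨m, hm, hoi⟩ := h
  contrapose! hn
  have key : ¬ ∃ k ∈ rhoPO T g, SubsPOOI k g' := fun ⟨k, hk, hk'⟩ => hn k hk hk'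
  refine subsPOOI_symm_of_surj (m := m) (fun y hy => ?_) (fun v hv w hw hvw => ?_)
    (fun v hv => ?_) (fun e he => ?_)
  · by_contra! h
    exact key (exists_rhoPO_addVertex hT hg' hm hoi hy h)
  · by_contra h
    exact key (exists_rhoPO_addEdge hT hm hoi hv hw h hvw)
  · by_contra h
    exact key (exists_rhoPO_refineVertex T hm hoi hv ((hm.2.2.1 v hv).lt_of_not_ge h))
  · by_contra h
    exact key (exists_rhoPO_refineEdge T hm hoi he ((hm.2.2.2 e he).lt_of_not_ge h))

theorem exists_reflTransGen_rhoPO [Finite L] {T : L} (hT : ∀ a : L, T ≤ a) {g g' : DLG L}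
    (hg' : g'.Connected) (h : SubsPOOI g g') :
    ∃ k : DLG L, Relation.ReflTransGen (fun x y => y ∈ rhoPO T x) g k ∧
      SubsPOOI k g' ∧ SubsPOOI g' k := by
  induction hd : g'.weight - g.weight using Nat.strong_induction_on generalizing g with
  | _ d ih =>
    by_cases hn : SubsPOOI g' g
    · exact ⟨g, .refl, h, hn⟩
    · obtain ⟨k, hk, hkg'⟩ := exists_rhoPO_subsPOOI hT hg' h hn
      have h₁ := weight_lt_of_mem_rhoPO hk
      have h₂ := hkg'.weight_le
      obtain ⟨l, hl, hl'⟩ := ih _ (by omega) hkg' rfl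
      exact ⟨l, .head hk hl, hl'⟩

end Refinement

end DLG

theorem rhoPO_ideal_under_OI {L : Type} [Fintype L] [PartialOrder L] (T : L) (hT : ∀ a : L, T ≤ a) :
    -- locally finite
    (∀ g : DLG L, g.Connected → (DLG.rhoPO T g).Finite) ∧
    -- complete: if g₁ strictly subsumes g₂, a finite chain of refinements starting
    -- at g₁ reaches a graph equivalent to g₂
    (∀ g₁ g₂ : DLG L, g₁.Connected → g₂.Connected →
      DLG.SubsPOOI g₁ g₂ → ¬ DLG.SubsPOOI g₂ g₁ →
      ∃ h : DLG L, Relation.ReflTransGen (fun x y => y ∈ DLG.rhoPO T x) g₁ h ∧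
        DLG.SubsPOOI h g₂ ∧ DLG.SubsPOOI g₂ h) ∧
    -- proper: no refinement of g is equivalent to g
    (∀ g : DLG L, g.Connected → ∀ g' ∈ DLG.rhoPO T g,
      ¬ (DLG.SubsPOOI g g' ∧ DLG.SubsPOOI g' g)) := by
  exact ⟨fun g _ => DLG.finite_rhoPO T g,
    fun _ _ _ hg₂ h _ => DLG.exists_reflTransGen_rhoPO hT hg₂ h,
    fun _ _ _ hg' h => (DLG.weight_lt_of_mem_rhoPO hg').not_ge h.2.weight_le⟩
end
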